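/- arXiv:0710.0834 — 2 statements merged into one kernel-verified Lean document; each statement's English description precedes it below -/
import Mathlib

section
/- If two n-linear forms F and G (n ≥ 2) on finite-dimensional real vector spaces are symmetrically equivalent, then there exist decompositions F = F₁ ⊕ F₂ and G = G₁ ⊕ G₂ such that F₁ is congruent to G₁ and F₂ is congruent to −G₂. -/
section Defs

variable {K : Type*} [Field K] {n : ℕ}

/-- The restriction of a multilinear form to a submodule. -/
def formRestrict {U : Type*} [AddCommGroup U] [Module K U]
    (F : MultilinearMap K (fun _ : Fin n => U) K) (W : Submodule K U) :
    MultilinearMap K (fun _ : Fin n => W) K :=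
  F.compLinearMap fun _ => W.subtype

/-- Two multilinear forms are congruent if a single linear bijection carries one to the other. -/
def FormCongruent {U V : Type*} [AddCommGroup U] [Module K U] [AddCommGroup V] [Module K V]
    (F : MultilinearMap K (fun _ : Fin n => U) K)
    (G : MultilinearMap K (fun _ : Fin n => V) K) : Prop :=
  ∃ φ : U ≃ₗ[K] V, ∀ u : Fin n → U, F u = G fun i => φ (u i)

/-- Symmetric equivalence of multilinear forms. -/
def FormSymmEquiv {U V : Type*} [AddCommGroup U] [Module K U] [AddCommGroup V] [Module K V]
    (F : MultilinearMap K (fun _ : Fin n => U) K)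
    (G : MultilinearMap K (fun _ : Fin n => V) K) : Prop :=
  ∃ φ : Fin n → U ≃ₗ[K] V, ∀ (σ : Equiv.Perm (Fin n)) (u : Fin n → U),
    F u = G fun i => φ (σ i) (u i)

/-- `W` is a direct-sum decomposition of the underlying space for which `F` vanishes on
mixed tuples, i.e. `F = ⨁ᵢ F|Wᵢ`. -/
def IsDecompFamily {U : Type*} [AddCommGroup U] [Module K U] {ι : Type*} [DecidableEq ι]
    (F : MultilinearMap K (fun _ : Fin n => U) K) (W : ι → Submodule K U) : Prop :=
  DirectSum.IsInternal W ∧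
    ∀ (x : Fin n → U) (k l : Fin n) (i j : ι), i ≠ j → x k ∈ W i → x l ∈ W j → F x = 0

/-- A multilinear form is indecomposable if in every direct-sum decomposition one of the
two subspaces is zero. -/
def FormIndecomposable {U : Type*} [AddCommGroup U] [Module K U]
    (F : MultilinearMap K (fun _ : Fin n => U) K) : Prop :=
  ∀ W₁ W₂ : Submodule K U, IsCompl W₁ W₂ →
    (∀ (x : Fin n → U) (k l : Fin n), x k ∈ W₁ → x l ∈ W₂ → F x = 0) →
    W₁ = ⊥ ∨ W₂ = ⊥

/-- A multilinear form has no zero direct summands if in every direct-sum decomposition the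
summand that is the zero form corresponds to the zero subspace. -/
def FormNoZeroSummand {U : Type*} [AddCommGroup U] [Module K U]
    (F : MultilinearMap K (fun _ : Fin n => U) K) : Prop :=
  ∀ W₁ W₂ : Submodule K U, IsCompl W₁ W₂ →
    (∀ (x : Fin n → U) (k l : Fin n), x k ∈ W₁ → x l ∈ W₂ → F x = 0) →
    (∀ x : Fin n → U, (∀ k, x k ∈ W₂) → F x = 0) → W₂ = ⊥

/-- A linear map `τ` is `G`-selfadjoint if applying `τ` in any one argument of `G`
gives the same value regardless of the argument chosen. -/
def FormSelfAdjoint {V : Type*} [AddCommGroup V] [Module K V]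
    (G : MultilinearMap K (fun _ : Fin n => V) K) (τ : V →ₗ[K] V) : Prop :=
  ∀ (v : Fin n → V) (i j : Fin n),
    G (Function.update v i (τ (v i))) = G (Function.update v j (τ (v j)))

end Defs

/-- In a field which is finite over `ℝ`, every nonzero element is an `n`-th power up to sign. -/
lemma exists_sq_eq_one_pow_eq_of_field {L : Type*} [Field L] [Algebra ℝ L] [Module.Finite ℝ L]
    {n : ℕ} (hn : n ≠ 0) (u : L) : ∃ ε κ : L, ε ^ 2 = 1 ∧ κ ^ n = ε * u := by
  rcases Real.nonempty_algEquiv_or L with ⟨⟨e⟩⟩ | ⟨⟨e⟩⟩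
  · obtain ⟨r, hr⟩ : ∃ r : ℝ, r ^ n = |e u| :=
      ⟨|e u| ^ (n⁻¹ : ℝ), Real.rpow_inv_natCast_pow (abs_nonneg _) hn⟩
    rcases abs_choice (e u) with h | h
    · exact ⟨1, e.symm r, by simp, e.injective (by simp [hr, h])⟩
    · exact ⟨-1, e.symm r, by simp, e.injective (by simp [hr, h])⟩
  · obtain ⟨z, hz⟩ := IsAlgClosed.exists_pow_nat_eq (e u) (Nat.pos_of_ne_zero hn)
    exact ⟨1, e.symm z, by simp, e.injective (by simp [hz])⟩

/-- In a finite-dimensional commutative real algebra, every unit is an `n`-th power up to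
multiplication by an involution. -/
lemma exists_sq_eq_one_pow_eq {R : Type*} [CommRing R] [Algebra ℝ R] [Module.Finite ℝ R]
    {n : ℕ} (hn : n ≠ 0) {u : R} (hu : IsUnit u) : ∃ ε κ : R, ε ^ 2 = 1 ∧ κ ^ n = ε * u := by
  have : IsArtinianRing R := IsArtinianRing.of_finite ℝ R
  have lift (f : ∀ I : MaximalSpectrum R, R ⧸ I.asIdeal) :
      ∃ r : R, ∀ I : MaximalSpectrum R, Ideal.Quotient.mk I.asIdeal r = f I := by
    obtain ⟨q, hq⟩ := (IsArtinianRing.quotNilradicalEquivPi R).surjective f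
    obtain ⟨r, rfl⟩ := Ideal.Quotient.mk_surjective q
    exact ⟨r, fun I ↦ congrFun hq I⟩
  have nilp (x : R) (hx : ∀ I : MaximalSpectrum R, Ideal.Quotient.mk I.asIdeal x = 0) :
      IsNilpotent x := by
    rw [← mem_nilradical, IsArtinianRing.nilradical_eq_iInf, Ideal.mem_iInf]
    exact fun I ↦ Ideal.Quotient.eq_zero_iff_mem.1 (hx I)
  have root (I : MaximalSpectrum R) : ∃ ε κ : R ⧸ I.asIdeal,
      ε ^ 2 = 1 ∧ κ ^ n = ε * Ideal.Quotient.mk I.asIdeal u := by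
    let := Ideal.Quotient.field I.asIdeal
    exact exists_sq_eq_one_pow_eq_of_field hn _
  have unit_of_pow {x y : R} {m : ℕ} (hm : m ≠ 0) (hy : IsUnit y) (h : IsNilpotent (x ^ m - y)) :
      IsUnit x := by
    rw [← isUnit_pow_iff hm, ← sub_add_cancel (x ^ m) y]
    exact h.isUnit_add_right_of_commute hy (Commute.all _ _)
  have unit_natCast {m : ℕ} (hm : m ≠ 0) : IsUnit (m : R) := by
    simpa using (IsUnit.mk0 (m : ℝ) (by exact_mod_cast hm)).map (algebraMap ℝ R)
  have improve {x y : R} {m : ℕ} (hm : m ≠ 0) (hy : IsUnit y) (h : IsNilpotent (x ^ m - y)) :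
      ∃ r, IsNilpotent (x - r) ∧ r ^ m = y := by
    obtain ⟨r, ⟨h₁, h₂⟩, -⟩ := Polynomial.existsUnique_nilpotent_sub_and_aeval_eq_zero
      (P := (Polynomial.X ^ m - Polynomial.C y : Polynomial R)) (x := x) (by simpa using h)
      (by simpa [Polynomial.derivative_X_pow] using (unit_natCast hm).mul ((unit_of_pow hm hy h).pow _))
    exact ⟨r, h₁, by simpa [sub_eq_zero] using h₂⟩
  choose e k he hk using root
  obtain ⟨e₀, he₀⟩ := lift e
  obtain ⟨k₀, hk₀⟩ := lift k
  obtain ⟨ε, hε, hε2⟩ := improve (x := e₀) two_ne_zero isUnit_one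
    (nilp _ fun I ↦ by simp [he₀, he])
  have hεI (I : MaximalSpectrum R) : Ideal.Quotient.mk I.asIdeal ε = e I := by
    rw [← mem_nilradical, IsArtinianRing.nilradical_eq_iInf, Ideal.mem_iInf] at hε
    rw [← he₀, eq_comm, Ideal.Quotient.eq]
    exact hε I
  obtain ⟨κ, -, hκ⟩ := improve (x := k₀) (y := ε * u) hn
    ((IsUnit.of_mul_eq_one ε (by rw [← sq, hε2])).mul hu)
    (nilp _ fun I ↦ by simp [hk₀, hk, hεI])
  exact ⟨ε, κ, hε2, hκ⟩

/-- Every linear automorphism `ρ` of a finite-dimensional real vector space is an `n`-th power up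
to an involution, with both the root and the involution polynomial in `ρ`. -/
lemma exists_mem_adjoin_sq_eq_one_pow_eq {V : Type*} [AddCommGroup V] [Module ℝ V]
    [FiniteDimensional ℝ V] {n : ℕ} (hn : n ≠ 0) {ρ : Module.End ℝ V}
    (hρ : Function.Injective ρ) :
    ∃ ε ∈ Algebra.adjoin ℝ {ρ}, ∃ κ ∈ Algebra.adjoin ℝ {ρ}, ε ^ 2 = 1 ∧ κ ^ n = ε * ρ := by
  have hu : IsUnit (⟨ρ, Algebra.self_mem_adjoin_singleton ℝ ρ⟩ : Algebra.adjoin ℝ {ρ}) := by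
    have : IsArtinianRing (Algebra.adjoin ℝ {ρ}) := IsArtinianRing.of_finite ℝ _
    refine IsArtinianRing.isUnit_of_mem_nonZeroDivisors (mem_nonZeroDivisors_iff_right.2 ?_)
    intro y hy
    rw [mul_comm] at hy
    refine Subtype.ext (LinearMap.ext fun v ↦ hρ ?_)
    have h : ρ (y.1 v) = 0 := LinearMap.congr_fun (congrArg Subtype.val hy) v
    simpa using h
  obtain ⟨ε, κ, hε, hκ⟩ := exists_sq_eq_one_pow_eq hn hu
  exact ⟨ε, ε.2, κ, κ.2, congrArg Subtype.val hε, congrArg Subtype.val hκ⟩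

section SelfAdjoint

variable {K V : Type*} [Field K] [AddCommGroup V] [Module K V] {n : ℕ}
  {G : MultilinearMap K (fun _ : Fin n => V) K}

lemma FormSelfAdjoint.mul {σ τ : Module.End K V} (hσ : FormSelfAdjoint G σ)
    (hτ : FormSelfAdjoint G τ) (hc : σ * τ = τ * σ) : FormSelfAdjoint G (σ * τ) := by
  intro v i j
  rcases eq_or_ne i j with rfl | hij
  · rfl
  have h₁ := hσ (Function.update v i (τ (v i))) i j
  have h₂ := hτ (Function.update v j (σ (v j))) i j
  simp only [Function.update_self, Function.update_idem, ne_eq, hij, hij.symm,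
    not_false_eq_true, Function.update_of_ne] at h₁ h₂
  rw [Function.update_comm hij.symm, ← h₁] at h₂
  rw [Module.End.mul_apply, h₂, hc, Module.End.mul_apply]

/-- The self-adjoint maps in a commutative family generate an algebra of self-adjoint maps. -/
lemma FormSelfAdjoint.of_mem_adjoin {ρ τ : Module.End K V} (hρ : FormSelfAdjoint G ρ)
    (hτ : τ ∈ Algebra.adjoin K {ρ}) : FormSelfAdjoint G τ := by
  induction hτ using Algebra.adjoin_induction with
  | mem x hx => rwa [Set.mem_singleton_iff.1 hx]
  | algebraMap r => intro v i j; simp [Module.algebraMap_end_apply]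
  | add x y _ _ hx hy =>
    intro v i j
    simp [MultilinearMap.map_update_add, hx v i j, hy v i j]
  | mul x y hx' hy' hx hy =>
    exact hx.mul hy (congrArg Subtype.val
      (mul_comm (⟨x, hx'⟩ : Algebra.adjoin K {ρ}) ⟨y, hy'⟩))

/-- Self-adjoint maps applied in the arguments listed in `l` can be collected in one
argument `i`. -/
lemma map_ite_mem_eq_map_update_prod {τ : Fin n → Module.End K V}
    (hτ : ∀ k, FormSelfAdjoint G (τ k)) {l : List (Fin n)} (hl : l.Nodup) {i : Fin n}
    (hi : i ∉ l) (v : Fin n → V) :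
    G (fun k => if k ∈ l then τ k (v k) else v k) =
      G (Function.update v i ((l.map τ).prod (v i))) := by
  induction l generalizing v with
  | nil => simp
  | cons a l ih =>
    obtain ⟨hal, hl⟩ := List.nodup_cons.1 hl
    obtain ⟨hia, hi⟩ := not_or.1 (List.mem_cons.not.1 hi)
    have h₁ : (fun k => if k ∈ a :: l then τ k (v k) else v k) =
        fun k => if k ∈ l then τ k (Function.update v a (τ a (v a)) k)
          else Function.update v a (τ a (v a)) k := by
      funext k
      rcases eq_or_ne k a with rfl | hk <;> simp [*]
    have h₂ := hτ a (Function.update v i ((l.map τ).prod (v i))) i a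
    simp only [Function.update_self, Function.update_idem, Function.update_of_ne (Ne.symm hia)]
      at h₂
    rw [h₁, ih hl hi, Function.update_of_ne hia, Function.update_comm (Ne.symm hia), List.map_cons,
      List.prod_cons, Module.End.mul_apply, h₂]

lemma FormSelfAdjoint.map_pow {κ : Module.End K V} (hκ : FormSelfAdjoint G κ) (i : Fin n)
    (v : Fin n → V) : G (fun k => κ (v k)) = G (Function.update v i ((κ ^ n) (v i))) := by
  have h := map_ite_mem_eq_map_update_prod (τ := fun _ => κ) (fun _ => hκ)
    (l := (List.finRange n).erase i) ((List.nodup_finRange n).erase i)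
    (i := i) (by simp [(List.nodup_finRange n).mem_erase_iff]) (Function.update v i (κ (v i)))
  have hn : n - 1 + 1 = n := by have := i.pos; omega
  simp only [Function.update_self, Function.update_idem, List.map_const', List.prod_replicate,
    List.length_erase_of_mem (List.mem_finRange i), List.length_finRange,
    ← Module.End.mul_apply, ← pow_succ, hn] at h
  rw [← h]
  congr 1
  funext k
  rcases eq_or_ne k i with rfl | hk <;> simp [(List.nodup_finRange n).mem_erase_iff, *]

/-- Distinct eigenspaces of a self-adjoint map are orthogonal. -/
lemma FormSelfAdjoint.map_eq_zero {ε : Module.End K V} (hε : FormSelfAdjoint G ε)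
    {a b : K} (hab : a ≠ b) {x : Fin n → V} {k l : Fin n} (hk : ε (x k) = a • x k)
    (hl : ε (x l) = b • x l) : G x = 0 := by
  have h := hε x k l
  rw [hk, hl, MultilinearMap.map_update_smul, MultilinearMap.map_update_smul,
    Function.update_eq_self, Function.update_eq_self, ← sub_eq_zero, ← sub_smul] at h
  exact (smul_eq_zero.1 h).resolve_left (sub_ne_zero.2 hab)

end SelfAdjoint

section SymmEquiv

variable {K U V : Type*} [Field K] [AddCommGroup U] [Module K U] [AddCommGroup V] [Module K V]
  {n : ℕ} {F : MultilinearMap K (fun _ : Fin n => U) K}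
  {G : MultilinearMap K (fun _ : Fin n => V) K}

lemma formSelfAdjoint_comp_symm {φ : Fin n → U ≃ₗ[K] V}
    (hφ : ∀ (σ : Equiv.Perm (Fin n)) (u : Fin n → U), F u = G fun i => φ (σ i) (u i))
    (o k : Fin n) : FormSelfAdjoint G ((φ k : U →ₗ[K] V) ∘ₗ ((φ o).symm : V →ₗ[K] U)) := by
  intro v i j
  rcases eq_or_ne i j with rfl | hij
  · rfl
  rcases eq_or_ne k o with rfl | hk
  · simp
  obtain ⟨σ, hi, hj⟩ : ∃ σ : Equiv.Perm (Fin n), σ i = k ∧ σ j = o := by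
    have hne : k ≠ Equiv.swap i k j := fun h ↦ hij (by
      simpa using congrArg (Equiv.swap i k) h)
    refine ⟨(Equiv.swap i k).trans (Equiv.swap (Equiv.swap i k j) o), ?_, by simp⟩
    simp [Equiv.swap_apply_of_ne_of_ne hne hk]
  let u : Fin n → U := fun m => if m = i ∨ m = j then (φ o).symm (v m) else (φ (σ m)).symm (v m)
  have h := (hφ σ u).symm.trans (hφ ((Equiv.swap i j).trans σ) u)
  convert h using 2
  · funext m
    rcases eq_or_ne m i with rfl | hmi
    · simp [u, hi]
    rcases eq_or_ne m j with rfl | hmj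
    · simp [u, hj, hmi]
    simp [u, hmi, hmj]
  · funext m
    rcases eq_or_ne m i with rfl | hmi
    · simp [u, hj, hij]
    rcases eq_or_ne m j with rfl | hmj
    · simp [u, hi]
    simp [u, hmi, hmj, Equiv.swap_apply_of_ne_of_ne]

/-- Symmetric equivalence is governed by a single isomorphism and a single self-adjoint
automorphism. -/
lemma FormSymmEquiv.exists_selfAdjoint (hn : 0 < n) (h : FormSymmEquiv F G) :
    ∃ (φ : U ≃ₗ[K] V) (ρ : Module.End K V), Function.Injective ρ ∧ FormSelfAdjoint G ρ ∧
      ∀ (i : Fin n) (u : Fin n → U),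
        F u = G (Function.update (fun k => φ (u k)) i (ρ (φ (u i)))) := by
  obtain ⟨φ, hφ⟩ := h
  let o : Fin n := ⟨0, hn⟩
  let τ (k : Fin n) : Module.End K V := (φ k : U →ₗ[K] V) ∘ₗ ((φ o).symm : V →ₗ[K] U)
  have hτ (k) : FormSelfAdjoint G (τ k) := formSelfAdjoint_comp_symm hφ o k
  let l := (List.finRange n).erase o
  have hl : l.Nodup := (List.nodup_finRange n).erase o
  have hmem (k) : k ∈ l ↔ k ≠ o := by simp [l, (List.nodup_finRange n).mem_erase_iff]
  have key (i : Fin n) (u : Fin n → U) :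
      F u = G (Function.update (fun k => φ o (u k)) i ((l.map τ).prod (φ o (u i)))) := by
    have hmem' (k) : k ∈ l.map (Equiv.swap i o) ↔ k ≠ i := by
      rw [← Equiv.swap_apply_self i o k, List.mem_map_of_injective (Equiv.injective _), hmem,
        not_iff_not, Equiv.swap_apply_self, Equiv.swap_apply_eq_iff, Equiv.swap_apply_right]
    have := map_ite_mem_eq_map_update_prod (τ := fun k => τ (Equiv.swap i o k)) (fun k => hτ _)
      (hl.map (Equiv.swap i o).injective) (i := i) (by simp [hmem']) (fun k => φ o (u k))
    rw [List.map_map] at this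
    have hcomp : (fun k => τ (Equiv.swap i o k)) ∘ Equiv.swap i o = τ := by
      funext k; simp
    rw [hcomp] at this
    rw [← this, hφ (Equiv.swap i o) u]
    congr 1
    funext k
    rcases eq_or_ne k i with rfl | hk
    · simp [hmem']
    · simp only [hmem', ne_eq, hk, not_false_eq_true, if_true]
      simp [τ]
  refine ⟨φ o, (l.map τ).prod, ?_, ?_, key⟩
  · suffices ∀ l : List (Fin n), Function.Injective (l.map τ).prod from this l
    intro l
    induction l with
    | nil => exact Function.injective_id
    | cons a l ih =>
      rw [List.map_cons, List.prod_cons, Module.End.coe_mul]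
      exact Function.Injective.comp ((φ a).injective.comp (φ o).symm.injective) ih
  · intro v i j
    have hi := key i fun k => (φ o).symm (v k)
    have hj := key j fun k => (φ o).symm (v k)
    simp only [LinearEquiv.apply_symm_apply] at hi hj
    exact hi.symm.trans hj

end SymmEquiv

/-- If two real multilinear forms are symmetrically equivalent, then they admit direct-sum
decompositions `F = F₁ ⊕ F₂`, `G = G₁ ⊕ G₂` such that `F₁` is congruent to `G₁` and `F₂` is
congruent to `-G₂`. -/
theorem stmt_2 {n : ℕ} (hn : 2 ≤ n) {U V : Type*}
    [AddCommGroup U] [Module ℝ U] [FiniteDimensional ℝ U]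
    [AddCommGroup V] [Module ℝ V] [FiniteDimensional ℝ V]
    (F : MultilinearMap ℝ (fun _ : Fin n => U) ℝ)
    (G : MultilinearMap ℝ (fun _ : Fin n => V) ℝ)
    (h : FormSymmEquiv F G) :
    ∃ (U₁ U₂ : Submodule ℝ U) (V₁ V₂ : Submodule ℝ V),
      IsCompl U₁ U₂ ∧ IsCompl V₁ V₂ ∧
      (∀ (x : Fin n → U) (k l : Fin n), x k ∈ U₁ → x l ∈ U₂ → F x = 0) ∧
      (∀ (x : Fin n → V) (k l : Fin n), x k ∈ V₁ → x l ∈ V₂ → G x = 0) ∧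
      FormCongruent (formRestrict F U₁) (formRestrict G V₁) ∧
      FormCongruent (formRestrict F U₂) (-(formRestrict G V₂)) := by

  have hpos : 0 < n := by omega
  obtain ⟨φ, ρ, hinj, hρ, hF⟩ := h.exists_selfAdjoint hpos
  obtain ⟨ε, hεmem, κ, hκmem, hε, hκ⟩ := exists_mem_adjoin_sq_eq_one_pow_eq hpos.ne' hinj
  have hεs := hρ.of_mem_adjoin hεmem
  have hκs := hρ.of_mem_adjoin hκmem
  have hεε (v : V) : ε (ε v) = v := by
    simpa [sq] using LinearMap.congr_fun hε v
  have hc : Commute ε κ := congrArg Subtype.val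
    (mul_comm (⟨ε, hεmem⟩ : Algebra.adjoin ℝ {ρ}) ⟨κ, hκmem⟩)
  have hcomm (v : V) : ε (κ v) = κ (ε v) := LinearMap.congr_fun hc v
  have hρε (v : V) : ρ v = (κ ^ n) (ε v) := by
    rw [← Module.End.mul_apply, ← (hc.pow_right n).eq, hκ, Module.End.mul_apply,
      Module.End.mul_apply, hεε]
  have hκinj : Function.Injective κ := by
    have hκn : Function.Injective (κ ^ n) := by
      rw [hκ, Module.End.coe_mul]
      exact (Function.LeftInverse.injective hεε).comp hinj
    rw [← Nat.sub_add_cancel hpos, pow_succ, Module.End.coe_mul] at hκn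
    exact hκn.of_comp
  have hVcompl : IsCompl (ε.eigenspace 1) (ε.eigenspace (-1)) := by
    refine ⟨Submodule.disjoint_def.2 fun v h₁ h₂ ↦ ?_,
      Submodule.codisjoint_iff_exists_add_eq.2 fun v ↦
        ⟨(2⁻¹ : ℝ) • (v + ε v), (2⁻¹ : ℝ) • (v - ε v), ?_, ?_, by module⟩⟩
    · rw [Module.End.mem_eigenspace_iff] at h₁ h₂
      rw [h₁, one_smul, neg_one_smul] at h₂
      have h : (2 : ℝ) • v = 0 := by rw [two_smul, ← eq_neg_iff_add_eq_zero]; exact h₂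
      exact (smul_eq_zero.1 h).resolve_left two_ne_zero
    · rw [Module.End.mem_eigenspace_iff, map_smul, map_add, hεε]
      module
    · rw [Module.End.mem_eigenspace_iff, map_smul, map_sub, hεε]
      module
  let ψ : V ≃ₗ[ℝ] V := LinearEquiv.ofInjectiveEndo κ hκinj
  let W (a : ℝ) : Submodule ℝ U := (ε.eigenspace a).comap (φ : U →ₗ[ℝ] V)
  have hW {a : ℝ} {u : U} (hu : u ∈ W a) : ε (φ u) = a • φ u := Module.End.mem_eigenspace_iff.1 hu
  have hFW (a : ℝ) (u : Fin n → U) (i : Fin n) (hu : u i ∈ W a) :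
      F u = a * G fun k => κ (φ (u k)) := by
    rw [hF i, hρε, hW hu, map_smul, MultilinearMap.map_update_smul, smul_eq_mul,
      hκs.map_pow i]
  have hκW {a : ℝ} {u : U} (hu : u ∈ W a) : κ (φ u) ∈ ε.eigenspace a := by
    rw [Module.End.mem_eigenspace_iff, hcomm, hW hu, map_smul]
  have hmap (a : ℝ) : (W a).map (φ.trans ψ : U →ₗ[ℝ] V) = ε.eigenspace a := by
    refine le_antisymm (Submodule.map_le_iff_le_comap.2 fun u hu ↦ hκW hu) fun w hw ↦ ?_
    obtain ⟨u, rfl⟩ := (φ.trans ψ).surjective w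
    refine Submodule.mem_map_of_mem (Module.End.mem_eigenspace_iff.2 (hκinj ?_))
    have h : ε (κ (φ u)) = a • κ (φ u) := Module.End.mem_eigenspace_iff.1 hw
    rw [← map_smul, hcomm] at h
    exact h
  let e (a : ℝ) : W a ≃ₗ[ℝ] ε.eigenspace a :=
    ((φ.trans ψ).submoduleMap (W a)).trans (LinearEquiv.ofEq _ _ (hmap a))
  have hGzero (x : Fin n → V) (k l : Fin n) (hk : x k ∈ ε.eigenspace 1)
      (hl : x l ∈ ε.eigenspace (-1)) : G x = 0 :=
    hεs.map_eq_zero (by norm_num) (Module.End.mem_eigenspace_iff.1 hk)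
      (Module.End.mem_eigenspace_iff.1 hl)
  refine ⟨W 1, W (-1), ε.eigenspace 1, ε.eigenspace (-1), ?_, hVcompl, ?_, hGzero,
    ⟨e 1, fun u ↦ ?_⟩, ⟨e (-1), fun u ↦ ?_⟩⟩
  · exact (Submodule.orderIsoMapComap φ).symm.isCompl hVcompl
  · intro x k l hk hl
    rw [hFW 1 x k hk, hGzero _ k l (hκW hk) (hκW hl), mul_zero]
  · exact (hFW 1 (fun k => u k) ⟨0, hpos⟩ (u _).2).trans (one_mul _)
  · exact (hFW (-1) (fun k => u k) ⟨0, hpos⟩ (u _).2).trans (neg_one_mul _)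
end

section
/- Let ε : S_n → {1, −1} be a function assigning a sign to each permutation, and let F and G be ε-symmetric n-linear forms (n ≥ 2) on finite-dimensional complex vector spaces. Then F and G are equivalent if and only if they are congruent. -/
section PolynomialRoots

open Polynomial

/-- A complex polynomial divides a power of any polynomial vanishing at all of its roots. -/
theorem Polynomial.dvd_pow_of_isRoot (m f : ℂ[X]) (hm : m ≠ 0) (h : ∀ r ∈ m.roots, f.IsRoot r) :
    m ∣ f ^ m.roots.card := by
  have hprod : (m.roots.map fun a => X - C a).prod ∣ (m.roots.map fun _ => f).prod :=
    Multiset.prod_dvd_prod_of_dvd _ _ fun a ha => dvd_iff_isRoot.2 (h a ha)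
  rw [Multiset.map_const', Multiset.prod_replicate] at hprod
  have hm' := (IsAlgClosed.splits m).eq_prod_roots
  have hc : IsUnit (C m.leadingCoeff) := isUnit_C.2 (by simpa using hm)
  nth_rewrite 1 [hm']
  exact (hc.mul_left_dvd).2 hprod

/-- `X` has an `N`-th root modulo every complex polynomial not vanishing at `0`. -/
theorem Polynomial.exists_dvd_pow_sub_X (m : ℂ[X]) (hm : m.coeff 0 ≠ 0) (N : ℕ) (hN : N ≠ 0) :
    ∃ q : ℂ[X], m ∣ q ^ N - X := by
  classical
  choose s hs using fun z : ℂ => IsAlgClosed.exists_pow_nat_eq z (Nat.pos_of_ne_zero hN)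
  let p : ℂ[X] := Lagrange.interpolate m.roots.toFinset id s
  have hp : ∀ r ∈ m.roots, (p ^ N - X).IsRoot r := by
    intro r hr
    have := Lagrange.eval_interpolate_at_node (v := id) s (Set.injOn_id _)
      (Multiset.mem_toFinset.2 hr)
    simp only [id] at this
    rw [IsRoot, eval_sub, eval_pow, eval_X, this, hs, sub_self]
  have hnil : IsNilpotent (AdjoinRoot.mk m (p ^ N - X)) :=
    ⟨m.roots.card, by
      rw [← map_pow]
      exact AdjoinRoot.mk_eq_zero.2 (dvd_pow_of_isRoot m _ (by rintro rfl; simp at hm) hp)⟩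
  have hX : IsUnit (AdjoinRoot.mk m X) := by
    obtain ⟨b, hb⟩ : ∃ b : ℂ[X], m = X * b + C (m.coeff 0) :=
      ⟨m.divX, (X_mul_divX_add m).symm⟩
    have h1 : AdjoinRoot.mk m X * AdjoinRoot.mk m (-b * C (m.coeff 0)⁻¹) = 1 := by
      rw [← map_mul, ← map_one (AdjoinRoot.mk m), AdjoinRoot.mk_eq_mk]
      refine ⟨-C (m.coeff 0)⁻¹, ?_⟩
      have hc : C (m.coeff 0) * C (m.coeff 0)⁻¹ = (1 : ℂ[X]) := by
        rw [← C_mul, mul_inv_cancel₀ hm, C_1]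
      linear_combination (-C (m.coeff 0)⁻¹) * (-hb) + hc
    exact IsUnit.of_mul_eq_one _ h1
  let x := AdjoinRoot.mk m p
  have hxN : IsUnit (x ^ N) := by
    have h := hnil.isUnit_add_left_of_commute hX (Commute.all _ _)
    simpa [x] using h
  have hx : IsUnit x := (isUnit_pow_iff hN).1 hxN
  have hNu : IsUnit (N : AdjoinRoot m) := by
    have : IsUnit (N : ℂ) := (Nat.cast_ne_zero.2 hN).isUnit
    simpa using this.map (algebraMap ℂ (AdjoinRoot m))
  obtain ⟨r, ⟨-, hr⟩, -⟩ := existsUnique_nilpotent_sub_and_aeval_eq_zero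
    (P := (X ^ N - C (AdjoinRoot.mk m X) : (AdjoinRoot m)[X])) (x := x)
    (by simpa [x] using hnil)
    (by simpa [derivative_X_pow] using And.intro hNu (hx.pow (N - 1)))
  obtain ⟨q, rfl⟩ := AdjoinRoot.mk_surjective r
  refine ⟨q, AdjoinRoot.mk_eq_zero.1 ?_⟩
  simpa using hr

/-- An injective endomorphism of a finite-dimensional complex space has an `N`-th root which is
a polynomial in it. -/
theorem LinearMap.exists_aeval_pow_eq {V : Type*} [AddCommGroup V] [Module ℂ V]
    [FiniteDimensional ℂ V] (ψ : Module.End ℂ V) (hψ : Function.Injective ψ)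
    (N : ℕ) (hN : N ≠ 0) : ∃ q : ℂ[X], aeval ψ q ^ N = ψ := by
  obtain ⟨q, hq⟩ := exists_dvd_pow_sub_X (minpoly ℂ ψ)
    (minpoly_coeff_zero_of_injective hψ) N hN
  refine ⟨q, ?_⟩
  have := (minpoly.dvd_iff).1 hq
  simpa [sub_eq_zero] using this

end PolynomialRoots

namespace FormSelfAdjoint

variable {K : Type*} [Field K] {n : ℕ} {V : Type*} [AddCommGroup V] [Module K V]
  {G : MultilinearMap K (fun _ : Fin n => V) K}

theorem mul_of_commute {σ τ : Module.End K V} (hσ : FormSelfAdjoint G σ)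
    (hτ : FormSelfAdjoint G τ) (h : Commute σ τ) : FormSelfAdjoint G (σ * τ) := by
  intro v i j
  rcases eq_or_ne i j with rfl | hij
  · rfl
  have h1 := hσ (Function.update v i (τ (v i))) i j
  have h2 := hτ (Function.update v j (σ (v j))) i j
  simp only [Function.update_self, Function.update_idem, Function.update_of_ne hij,
    Function.update_of_ne hij.symm] at h1 h2
  rw [Function.update_comm hij] at h1
  nth_rewrite 2 [h.eq]
  rw [Module.End.mul_apply, Module.End.mul_apply, h1, h2]

theorem one : FormSelfAdjoint G (1 : Module.End K V) := by
  intro v i j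
  simp

theorem pow {τ : Module.End K V} (hτ : FormSelfAdjoint G τ) (k : ℕ) :
    FormSelfAdjoint G (τ ^ k) := by
  induction k with
  | zero => simpa using one
  | succ k ih =>
    rw [pow_succ]
    exact ih.mul_of_commute hτ ((Commute.refl τ).pow_left k)

theorem add {σ τ : Module.End K V} (hσ : FormSelfAdjoint G σ)
    (hτ : FormSelfAdjoint G τ) : FormSelfAdjoint G (σ + τ) := by
  intro v i j
  simp only [LinearMap.add_apply, MultilinearMap.map_update_add]
  rw [hσ v i j, hτ v i j]

theorem smul {τ : Module.End K V} (hτ : FormSelfAdjoint G τ) (c : K) :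
    FormSelfAdjoint G (c • τ) := by
  intro v i j
  simp only [LinearMap.smul_apply, MultilinearMap.map_update_smul]
  rw [hτ v i j]

theorem aeval {τ : Module.End K V} (hτ : FormSelfAdjoint G τ) (p : Polynomial K) :
    FormSelfAdjoint G (Polynomial.aeval τ p) := by
  induction p using Polynomial.induction_on' with
  | add p q hp hq => simpa using hp.add hq
  | monomial k c =>
    rw [Polynomial.aeval_monomial, ← Algebra.smul_def]
    exact (hτ.pow k).smul c

/-- A power of a selfadjoint map in one argument can be spread over several arguments. -/
theorem map_update_pow {ρ : Module.End K V} (hρ : FormSelfAdjoint G ρ) (j : Fin n)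
    (S : Finset (Fin n)) (hj : j ∉ S) (v : Fin n → V) :
    G (Function.update v j ((ρ ^ (S.card + 1)) (v j))) =
      G fun i => if i ∈ insert j S then ρ (v i) else v i := by
  induction S using Finset.induction_on generalizing v with
  | empty =>
    congr 1
    ext i
    by_cases h : i = j
    · subst h; simp
    · simp [h]
  | insert a S ha ih =>
    have hja : j ≠ a := fun h => hj (by simp [h])
    have hjS : j ∉ S := fun h => hj (by simp [h])
    have h1 := hρ (Function.update v j ((ρ ^ (S.card + 1)) (v j))) j a
    have h2 := ih hjS (Function.update v a (ρ (v a)))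
    simp only [Function.update_self, Function.update_idem, Function.update_of_ne hja,
      Function.update_of_ne hja.symm] at h1 h2
    rw [Finset.card_insert_of_notMem ha, pow_succ', Module.End.mul_apply, h1,
      Function.update_comm hja, h2]
    congr 1
    ext i
    by_cases h : i = a
    · subst h; simp [ha, hja.symm]
    · simp [h]

end FormSelfAdjoint

section SymmetricForms

variable {K : Type*} [Field K] {n : ℕ} {U V : Type*} [AddCommGroup U] [Module K U]
  [AddCommGroup V] [Module K V] {ε : Equiv.Perm (Fin n) → K}
  {F : MultilinearMap K (fun _ : Fin n => U) K} {G : MultilinearMap K (fun _ : Fin n => V) K}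

/-- Equivalent `ε`-symmetric forms are symmetrically equivalent. -/
theorem map_perm_of_equiv (hε : ∀ σ, ε σ ≠ 0)
    (hF : ∀ (σ : Equiv.Perm (Fin n)) (u : Fin n → U), F (fun i => u (σ i)) = ε σ * F u)
    (hG : ∀ (σ : Equiv.Perm (Fin n)) (v : Fin n → V), G (fun i => v (σ i)) = ε σ * G v)
    (φ : Fin n → U ≃ₗ[K] V) (h : ∀ u : Fin n → U, F u = G fun i => φ i (u i))
    (σ : Equiv.Perm (Fin n)) (u : Fin n → U) : F u = G fun i => φ (σ i) (u i) := by
  have h1 := hG σ.symm fun i => φ (σ i) (u i)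
  simp only [Equiv.apply_symm_apply] at h1
  have h2 := hF σ.symm u
  rw [h, h1] at h2
  exact (mul_left_cancel₀ (hε _) h2).symm

/-- The quotient of two of the bijections in a symmetric equivalence is selfadjoint. -/
theorem formSelfAdjoint_of_symmEquiv (φ : Fin n → U ≃ₗ[K] V)
    (h : ∀ (σ : Equiv.Perm (Fin n)) (u : Fin n → U), F u = G fun i => φ (σ i) (u i))
    {i j : Fin n} (hij : i ≠ j) :
    FormSelfAdjoint G ((φ i).symm.trans (φ j) : V →ₗ[K] V) := by
  intro v a b
  rcases eq_or_ne a b with rfl | hab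
  · rfl
  obtain ⟨σ, hσa, hσb⟩ : ∃ σ : Equiv.Perm (Fin n), σ a = i ∧ σ b = j := by
    refine ⟨Equiv.swap (Equiv.swap a i b) j * Equiv.swap a i, ?_, ?_⟩
    · rw [Equiv.Perm.mul_apply, Equiv.swap_apply_left, Equiv.swap_apply_of_ne_of_ne _ hij]
      intro h
      rw [eq_comm, Equiv.swap_apply_eq_iff, Equiv.swap_apply_right] at h
      exact hab h.symm
    · rw [Equiv.Perm.mul_apply, Equiv.swap_apply_left]
  let u : Fin n → U := fun k => if k = a ∨ k = b then (φ i).symm (v k) else (φ (σ k)).symm (v k)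
  have h1 := h σ u
  rw [h (Equiv.swap i j * σ) u] at h1
  convert h1 using 2 with k k
  · ext k
    by_cases hka : k = a
    · subst hka; simp [u, hσa]
    by_cases hkb : k = b
    · subst hkb; simp [u, hσb, hka]
    have hi : σ k ≠ i := fun h => hka (σ.injective (h.trans hσa.symm))
    have hj : σ k ≠ j := fun h => hkb (σ.injective (h.trans hσb.symm))
    simp [u, hka, hkb, Equiv.swap_apply_of_ne_of_ne hi hj]
  · ext k
    by_cases hkb : k = b
    · subst hkb; simp [u, hσb]
    by_cases hka : k = a
    · subst hka; simp [u, hσa, hkb]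
    simp [u, hka, hkb]

end SymmetricForms

/-- In an equivalence of `ε`-symmetric complex forms, the bijections indexed by any set of
arguments can be made equal. -/
theorem exists_equiv_eqOn {n : ℕ} {U V : Type*}
    [AddCommGroup U] [Module ℂ U] [AddCommGroup V] [Module ℂ V] [FiniteDimensional ℂ V]
    {ε : Equiv.Perm (Fin n) → ℂ} (hε : ∀ σ, ε σ ≠ 0)
    {F : MultilinearMap ℂ (fun _ : Fin n => U) ℂ}
    {G : MultilinearMap ℂ (fun _ : Fin n => V) ℂ}
    (hF : ∀ (σ : Equiv.Perm (Fin n)) (u : Fin n → U), F (fun i => u (σ i)) = ε σ * F u)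
    (hG : ∀ (σ : Equiv.Perm (Fin n)) (v : Fin n → V), G (fun i => v (σ i)) = ε σ * G v)
    (φ : Fin n → U ≃ₗ[ℂ] V) (h : ∀ u : Fin n → U, F u = G fun i => φ i (u i))
    {S : Finset (Fin n)} (hS : S.Nonempty) :
    ∃ (φ' : Fin n → U ≃ₗ[ℂ] V) (χ : U ≃ₗ[ℂ] V),
      (∀ u : Fin n → U, F u = G fun i => φ' i (u i)) ∧ ∀ i ∈ S, φ' i = χ := by
  induction hS using Finset.Nonempty.cons_induction with
  | singleton j => exact ⟨φ, φ j, h, by simp⟩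
  | cons j S hj hS ih =>
    obtain ⟨φ, χ, h, hχ⟩ := ih
    obtain ⟨i, hi⟩ := hS
    have hij : i ≠ j := fun e => hj (e ▸ hi)
    have hψ := formSelfAdjoint_of_symmEquiv φ (map_perm_of_equiv hε hF hG φ h) hij
    rw [hχ i hi] at hψ
    obtain ⟨q, hq⟩ := LinearMap.exists_aeval_pow_eq
      (χ.symm.trans (φ j) : V →ₗ[ℂ] V) (χ.symm.trans (φ j)).injective (S.card + 1) (by simp)
    have hρ := hψ.aeval q
    set ρ := Polynomial.aeval (χ.symm.trans (φ j) : V →ₗ[ℂ] V) q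
    have hinj : Function.Injective ρ := by
      have hcomp : Function.Injective (ρ ^ (S.card + 1)) := by
        rw [hq]
        exact (χ.symm.trans (φ j)).injective
      rw [pow_succ, Module.End.mul_eq_comp, LinearMap.coe_comp] at hcomp
      exact hcomp.of_comp
    let χ' : U ≃ₗ[ℂ] V := χ.trans (LinearEquiv.ofInjectiveEndo ρ hinj)
    refine ⟨fun k => if k ∈ insert j S then χ' else φ k, χ', fun u => ?_, fun k hk => ?_⟩
    · have h1 := hρ.map_update_pow j S hj fun k => if k = j then χ (u k) else φ k (u k)
      rw [hq] at h1
      rw [h u]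
      convert h1 using 2
      · ext k
        by_cases hkj : k = j
        · subst hkj; simp
        · simp [hkj]
      · ext k
        by_cases hkj : k = j
        · subst hkj; simp [χ']
        by_cases hkS : k ∈ S
        · simp [χ', hkS, hkj, hχ k hkS]
        · simp [hkS, hkj]
    · rw [Finset.cons_eq_insert] at hk
      simp only [hk, if_true]

/-- Two `ε`-symmetric multilinear forms over `ℂ` are equivalent iff they are congruent. -/
theorem stmt_10 {n : ℕ} (hn : 2 ≤ n) {U V : Type*}
    [AddCommGroup U] [Module ℂ U] [FiniteDimensional ℂ U]
    [AddCommGroup V] [Module ℂ V] [FiniteDimensional ℂ V]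
    (ε : Equiv.Perm (Fin n) → ℂ) (hε : ∀ σ, ε σ = 1 ∨ ε σ = -1)
    (F : MultilinearMap ℂ (fun _ : Fin n => U) ℂ)
    (G : MultilinearMap ℂ (fun _ : Fin n => V) ℂ)
    (hF : ∀ (σ : Equiv.Perm (Fin n)) (u : Fin n → U), F (fun i => u (σ i)) = ε σ * F u)
    (hG : ∀ (σ : Equiv.Perm (Fin n)) (v : Fin n → V), G (fun i => v (σ i)) = ε σ * G v) :
    (∃ φ : Fin n → U ≃ₗ[ℂ] V, ∀ u : Fin n → U, F u = G fun i => φ i (u i)) ↔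
      FormCongruent F G := by
  constructor
  · rintro ⟨φ, h⟩
    have hε₀ : ∀ σ, ε σ ≠ 0 := fun σ => by
      rcases hε σ with h | h <;> simp [h]
    have : Nonempty (Fin n) := ⟨⟨0, by omega⟩⟩
    obtain ⟨φ', χ, h', hχ⟩ := exists_equiv_eqOn hε₀ hF hG φ h Finset.univ_nonempty
    refine ⟨χ, fun u => ?_⟩
    simpa [hχ] using h' u
  · rintro ⟨φ, h⟩
    exact ⟨fun _ => φ, h⟩
end
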